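/- Let a : G → ℤ₂ be a group homomorphism, let b¹, b², b³, m, l ∈ C¹(G,ℤ₂⊕ℤ₂), and let κ_L¹, κ_R² ∈ C²(G,ℤ₂⊕ℤ₂). Define κ_L² := d¹ₐ(b² − b¹ − m) + κ_L¹ and κ_R³ := d¹ₐl + κ_R². Then for all g, h, k ∈ G: (−1)^{κ_L¹(g,h)·m(k)^{a(gh)}} · (−1)^{(b²(g)−b¹(g)−m(g))·κ_R²(h,k)^{a(g)}} · (−1)^{κ_L²(g,h)·l(k)^{a(gh)}} · (−1)^{(b³(g)−b²(g)−l(g))·κ_R³(h,k)^{a(g)}} = (−1)^{κ_L¹(g,h)·(l+m)(k)^{a(gh)}} · (−1)^{(b³(g)−b¹(g)−(l+m)(g))·κ_R³(h,k)^{a(g)}} · d²ₐσ″(g,h,k), where σ″ ∈ C²(G,U(1)⊕U(1)) is defined by σ″(g,h) := (−1)^{(b²(g)−b¹(g)−m(g))·l(h)^{a(g)}}. -/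

import Mathlib

noncomputable section

/-- `ℤ₂ ⊕ ℤ₂`, written additively with componentwise addition. -/
abbrev Z22 := ZMod 2 × ZMod 2

/-- `U(1) ⊕ U(1)`, written multiplicatively with componentwise multiplication,
where `U(1)` is the circle group. -/
abbrev U12 := Circle × Circle

/-- The `ℤ₂`-action on `ℤ₂ ⊕ ℤ₂`: `x^n = x` if `n = 0` and the swap of the two
components if `n = 1`. -/
def actZ (n : ZMod 2) (x : Z22) : Z22 := if n = 0 then x else (x.2, x.1)

/-- The `ℤ₂`-action on `U(1) ⊕ U(1)`: `x^n = x` if `n = 0` and the swap of the two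
components if `n = 1`. -/
def actU (n : ZMod 2) (x : U12) : U12 := if n = 0 then x else (x.2, x.1)

/-- The componentwise product `x·y` in the field `ℤ₂`. -/
def dotZ (x y : Z22) : Z22 := (x.1 * y.1, x.2 * y.2)

/-- `-1` as an element of the circle group. -/
def negOneC : Circle := ⟨-1, by simp [Submonoid.unitSphere]⟩

/-- `(−1)^x ∈ U(1) ⊕ U(1)` for `x ∈ ℤ₂ ⊕ ℤ₂`, componentwise. -/
def negPow (x : Z22) : U12 := (negOneC ^ x.1.val, negOneC ^ x.2.val)

variable {G : Type*} [Group G]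

/-- First twisted coboundary, for `ℤ₂ ⊕ ℤ₂`-valued cochains. -/
def d1Z (a : G → ZMod 2) (x : G → Z22) (g h : G) : Z22 :=
  actZ (a g) (x h) + x g - x (g * h)

/-- Second twisted coboundary, for `ℤ₂ ⊕ ℤ₂`-valued cochains. -/
def d2Z (a : G → ZMod 2) (y : G → G → Z22) (g h k : G) : Z22 :=
  actZ (a g) (y h k) + y g (h * k) - y (g * h) k - y g h

/-- Second twisted coboundary, for `U(1) ⊕ U(1)`-valued cochains. -/
def d2U (a : G → ZMod 2) (y : G → G → U12) (g h k : G) : U12 :=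
  actU (a g) (y h k) * y g (h * k) * (y (g * h) k)⁻¹ * (y g h)⁻¹

/-- Third twisted coboundary, for `U(1) ⊕ U(1)`-valued cochains. -/
def d3U (a : G → ZMod 2) (z : G → G → G → U12) (g h k f : G) : U12 :=
  actU (a g) (z h k f) * z g (h * k) f * z g h k *
    (z (g * h) k f)⁻¹ * (z g h (k * f))⁻¹

theorem negOneC_mul_self : negOneC * negOneC = 1 := by
  apply Circle.ext
  rw [Circle.coe_mul]
  exact neg_one_mul (-1 : ℂ) |>.trans (neg_neg 1)

theorem negOneC_pow_val_add (x y : ZMod 2) :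
    negOneC ^ (x + y).val = negOneC ^ x.val * negOneC ^ y.val := by
  rw [ZMod.val_add, ← pow_add]
  exact (pow_eq_pow_mod _ (by rw [pow_two, negOneC_mul_self])).symm

theorem negPow_add (x y : Z22) : negPow (x + y) = negPow x * negPow y :=
  Prod.ext (negOneC_pow_val_add _ _) (negOneC_pow_val_add _ _)

theorem negPow_inv (x : Z22) : (negPow x)⁻¹ = negPow x := by
  rw [inv_eq_iff_mul_eq_one, ← negPow_add, CharTwo.add_self_eq_zero]
  simp [negPow]

theorem actU_negPow (n : ZMod 2) (x : Z22) : actU n (negPow x) = negPow (actZ n x) := by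
  unfold actU actZ
  split_ifs <;> rfl

theorem actZ_add (n : ZMod 2) (x y : Z22) : actZ n (x + y) = actZ n x + actZ n y := by
  unfold actZ
  split_ifs <;> rfl

theorem actZ_sub (n : ZMod 2) (x y : Z22) : actZ n (x - y) = actZ n x - actZ n y := by
  unfold actZ
  split_ifs <;> rfl

theorem actZ_mul (n : ZMod 2) (x y : Z22) : actZ n (x * y) = actZ n x * actZ n y := by
  unfold actZ
  split_ifs <;> rfl

theorem actZ_actZ (m n : ZMod 2) (x : Z22) : actZ m (actZ n x) = actZ (m + n) x := by
  revert m n x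
  decide

theorem dotZ_eq_mul (x y : Z22) : dotZ x y = x * y := rfl

/-- **Lemma (phase-factor identity, Lemma 4.7 computation).**
With `κ_L² := d¹ₐ(b²−b¹−m) + κ_L¹` and `κ_R³ := d¹ₐl + κ_R²`, the product of the
four sign factors on the left equals the combined sign factor times `d²ₐσ″`,
where `σ″(g,h) := (−1)^{(b²(g)−b¹(g)−m(g))·l(h)^{a(g)}}`. -/
theorem sign_factor_identity (a : G → ZMod 2) (ha : ∀ g h, a (g * h) = a g + a h)
    (b1 b2 b3 m l : G → Z22) (kL1 kR2 kL2 kR3 : G → G → Z22)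
    (hkL2 : ∀ g h, kL2 g h = d1Z a (fun u => b2 u - b1 u - m u) g h + kL1 g h)
    (hkR3 : ∀ g h, kR3 g h = d1Z a l g h + kR2 g h)
    (g h k : G) :
    negPow (dotZ (kL1 g h) (actZ (a (g * h)) (m k))) *
    negPow (dotZ (b2 g - b1 g - m g) (actZ (a g) (kR2 h k))) *
    negPow (dotZ (kL2 g h) (actZ (a (g * h)) (l k))) *
    negPow (dotZ (b3 g - b2 g - l g) (actZ (a g) (kR3 h k))) =
      negPow (dotZ (kL1 g h) (actZ (a (g * h)) (l k + m k))) *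
      negPow (dotZ (b3 g - b1 g - (l g + m g)) (actZ (a g) (kR3 h k))) *
      d2U a (fun g' h' =>
        negPow (dotZ (b2 g' - b1 g' - m g') (actZ (a g') (l h')))) g h k := by
  simp only [d2U, actU_negPow, negPow_inv, ← negPow_add]
  congr 1
  simp only [hkL2, hkR3, d1Z, dotZ_eq_mul, actZ_add, actZ_sub, actZ_mul, actZ_actZ, ha]
  have two_eq_zero : (2 : Z22) = 0 := rfl
  linear_combination (-((b2 (g * h) - b1 (g * h) - m (g * h)) * actZ (a g + a h) (l k) +
    (b2 g - b1 g - m g) * actZ (a g) (l h))) * two_eq_zero
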